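/- Let $V_1, V_2$ be odd self-adjoint endomorphism families over a base $B$ of $\mathbb{Z}_2$-graded Hermitian vector bundles $\xi_1, \xi_2$, with $V_i(x)$ self-adjoint for each $x$. Then the support (non-invertibility locus) of the super tensor product endomorphism $V_1 \hat{\otimes} \mathrm{Id} + \mathrm{Id} \hat{\otimes} V_2$ equals $\mathrm{Supp}(V_1) \cap \mathrm{Supp}(V_2)$. -/

import Mathlib

open Kronecker Matrix

open scoped ComplexOrder

namespace Matrix

variable {m n : Type*} [Fintype m] [Fintype n]

/-- The square of a Hermitian matrix is positive semidefinite. -/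
theorem IsHermitian.posSemidef_mul_self {A : Matrix n n ℂ} (hA : A.IsHermitian) :
    (A * A).PosSemidef := by
  simpa only [hA.eq] using posSemidef_conjTranspose_mul_self A

variable [DecidableEq m] [DecidableEq n]

/-- The square of an invertible Hermitian matrix is positive definite. -/
theorem IsHermitian.posDef_mul_self {A : Matrix n n ℂ} (hA : A.IsHermitian) (hu : IsUnit A) :
    (A * A).PosDef :=
  hA.posSemidef_mul_self.posDef_iff_isUnit.mpr (hu.mul hu)

/-- The super tensor product endomorphism squares to `A² ⊗ 1 + 1 ⊗ C²`. -/
theorem superTensor_mul_self {A τ : Matrix n n ℂ} {C : Matrix m m ℂ}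
    (hτ : τ * τ = 1) (hodd : A * τ = -(τ * A)) :
    (A ⊗ₖ (1 : Matrix m m ℂ) + τ ⊗ₖ C) * (A ⊗ₖ (1 : Matrix m m ℂ) + τ ⊗ₖ C) =
      (A * A) ⊗ₖ (1 : Matrix m m ℂ) + (1 : Matrix n n ℂ) ⊗ₖ (C * C) := by
  have h : (A * τ) ⊗ₖ C + (τ * A) ⊗ₖ C = 0 := by
    rw [← add_kronecker, hodd, neg_add_cancel, zero_kronecker]
  simp only [add_mul, mul_add, ← mul_kronecker_mul, one_mul, mul_one, hτ]
  rw [← sub_eq_zero, ← h]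
  abel

/-- The super tensor product of two endomorphisms with nonzero kernels is not invertible. -/
theorem not_isUnit_superTensor {A : Matrix n n ℂ} (τ : Matrix n n ℂ) {C : Matrix m m ℂ}
    (hA : ¬ IsUnit A) (hC : ¬ IsUnit C) :
    ¬ IsUnit (A ⊗ₖ (1 : Matrix m m ℂ) + τ ⊗ₖ C) := by
  rw [isUnit_iff_isUnit_det, isUnit_iff_ne_zero, not_not, ← exists_mulVec_eq_zero_iff] at hA hC
  obtain ⟨v, hv, hAv⟩ := hA
  obtain ⟨w, hw, hCw⟩ := hC
  intro hu
  have h0 : (A ⊗ₖ (1 : Matrix m m ℂ) + τ ⊗ₖ C) *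
      (replicateCol Unit v ⊗ₖ replicateCol Unit w) = 0 := by
    rw [Matrix.add_mul, ← mul_kronecker_mul, ← mul_kronecker_mul, ← replicateCol_mulVec,
      ← replicateCol_mulVec C, hAv, hCw]
    simp
  have h1 := congrArg (fun M => (↑hu.unit⁻¹ : Matrix (n × m) (n × m) ℂ) * M) h0
  simp only [← Matrix.mul_assoc, hu.val_inv_mul, Matrix.one_mul, Matrix.mul_zero] at h1
  obtain ⟨i, hi⟩ := Function.ne_iff.mp hv
  obtain ⟨j, hj⟩ := Function.ne_iff.mp hw
  exact mul_ne_zero hi hj (congrFun (congrFun h1 (i, j)) ((), ()))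

/-- The super tensor product of Hermitian endomorphisms, the first of them odd, is invertible
iff one of the two factors is. -/
theorem isUnit_superTensor_iff {A τ : Matrix n n ℂ} {C : Matrix m m ℂ}
    (hA : A.IsHermitian) (hC : C.IsHermitian) (hτ : τ * τ = 1) (hodd : A * τ = -(τ * A)) :
    IsUnit (A ⊗ₖ (1 : Matrix m m ℂ) + τ ⊗ₖ C) ↔ IsUnit A ∨ IsUnit C := by
  refine ⟨fun hu => ?_, fun h => ?_⟩
  · by_contra! h
    exact not_isUnit_superTensor τ h.1 h.2 hu
  · suffices hpos : ((A * A) ⊗ₖ (1 : Matrix m m ℂ) + (1 : Matrix n n ℂ) ⊗ₖ (C * C)).PosDef by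
      rw [← superTensor_mul_self hτ hodd] at hpos
      exact isUnit_of_mul_isUnit_left hpos.isUnit
    rcases h with h | h
    · exact ((hA.posDef_mul_self h).kronecker PosDef.one).add_posSemidef
        (PosSemidef.one.kronecker hC.posSemidef_mul_self)
    · exact PosDef.posSemidef_add (hA.posSemidef_mul_self.kronecker PosSemidef.one)
        (PosDef.one.kronecker (hC.posDef_mul_self h))

end Matrix

/-- For families over a base `B` of odd self-adjoint endomorphisms `V₁, V₂` of
`ℤ₂`-graded Hermitian vector bundles (modeled by Hermitian matrices with grading
involutions `τ₁, τ₂`), the support of the super tensor product endomorphism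
`V₁ ⊗ 1 + τ₁ ⊗ V₂` is the intersection of the supports of `V₁` and `V₂`. -/
theorem support_superTensor_eq_inter
    (B : Type*) (n m : ℕ)
    (V1 : B → Matrix (Fin n) (Fin n) ℂ) (V2 : B → Matrix (Fin m) (Fin m) ℂ)
    (τ1 : Matrix (Fin n) (Fin n) ℂ) (τ2 : Matrix (Fin m) (Fin m) ℂ)
    (hτ1 : τ1.IsHermitian) (hτ2 : τ2.IsHermitian)
    (hτ1sq : τ1 * τ1 = 1) (hτ2sq : τ2 * τ2 = 1)
    (hherm1 : ∀ x, (V1 x).IsHermitian) (hherm2 : ∀ x, (V2 x).IsHermitian)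
    (hodd1 : ∀ x, V1 x * τ1 = -(τ1 * V1 x)) (hodd2 : ∀ x, V2 x * τ2 = -(τ2 * V2 x)) :
    {x | ¬ IsUnit (V1 x ⊗ₖ (1 : Matrix (Fin m) (Fin m) ℂ) + τ1 ⊗ₖ V2 x)} =
      {x | ¬ IsUnit (V1 x)} ∩ {x | ¬ IsUnit (V2 x)} := by
  ext x
  simp only [Set.mem_ofPred_eq, Set.mem_inter_iff,
    isUnit_superTensor_iff (hherm1 x) (hherm2 x) hτ1sq (hodd1 x), not_or]
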